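/- For every x > b, W^{(q)}(x) + α∫_b^x 𝕎^{(q)}(x−y) W^{(q)′}(y) dy = (1 − α W^{(q)}(0)) 𝕎^{(q)}(x) − α∫₀^b 𝕎^{(q)}(x−y) W^{(q)′}(y) dy. -/

import Mathlib

open MeasureTheory Set Filter Topology

/-- The Laplace exponent of a spectrally negative Lévy process with triplet `(γ, σ, ν)`. -/
noncomputable def levyPsi (γ σ : ℝ) (ν : Measure ℝ) (l : ℝ) : ℝ :=
  γ * l + σ ^ 2 / 2 * l ^ 2 +
    ∫ z in Set.Ioi (0 : ℝ),
      (Real.exp (-l * z) - 1 +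
        l * z * Set.indicator (Set.Ioc (0 : ℝ) 1) (fun _ => (1 : ℝ)) z) ∂ν

/-- The right-inverse `Φ(q) = sup {λ ≥ 0 : f(λ) = q}` of a Laplace exponent `f`. -/
noncomputable def levyPhi (f : ℝ → ℝ) (q : ℝ) : ℝ :=
  sSup {l : ℝ | 0 ≤ l ∧ f l = q}

/-- `∫₀¹ z ν(dz)`, as an extended nonnegative real. -/
noncomputable def smallJumpMass (ν : Measure ℝ) : ENNReal :=
  ∫⁻ z in Set.Ioc (0 : ℝ) 1, ENNReal.ofReal z ∂ν

/-- `ν` is a Lévy measure on `(0,∞)`: it charges only `(0,∞)` and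
integrates `min(1, z²)`. -/
def IsLevyMeasure (ν : Measure ℝ) : Prop :=
  ν (Set.Iic 0) = 0 ∧ (∫⁻ z in Set.Ioi (0 : ℝ), ENNReal.ofReal (min 1 (z ^ 2)) ∂ν) ≠ ⊤

/-- The process is not the negative of a subordinator: `σ > 0`, or
`∫₀¹ z ν(dz) = ∞`, or `γ + ∫₀¹ z ν(dz) > 0`. -/
def NonDegenerate (γ σ : ℝ) (ν : Measure ℝ) : Prop :=
  0 < σ ∨ smallJumpMass ν = ⊤ ∨ 0 < γ + (smallJumpMass ν).toReal

/-- `W` is the `q`-scale function associated with the Laplace exponent `f`,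
where `Φq` is the value of the right-inverse of `f` at `q`. -/
def IsScaleFunction (f : ℝ → ℝ) (Φq q : ℝ) (W : ℝ → ℝ) : Prop :=
  (∀ x < 0, W x = 0) ∧ ContinuousOn W (Set.Ici 0) ∧ MonotoneOn W (Set.Ici 0) ∧
    ∀ l, Φq < l → (∫ y in Set.Ioi (0 : ℝ), Real.exp (-l * y) * W y) = 1 / (f l - q)

/-- Admissibility of the refraction parameter `α`: `α > 0`, and when the paths
have bounded variation (`σ = 0` and `∫₀¹ z ν(dz) < ∞`), `α` is smaller than the
drift `c = γ + ∫₀¹ z ν(dz)`. -/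
def AlphaAdmissible (γ σ α : ℝ) (ν : Measure ℝ) : Prop :=
  0 < α ∧ ((σ = 0 ∧ smallJumpMass ν ≠ ⊤) → α < γ + (smallJumpMass ν).toReal)

/-- The integrand of the jump part of the Laplace exponent. -/
noncomputable def levyIntegrand (l z : ℝ) : ℝ :=
  Real.exp (-l * z) - 1 + l * z * Set.indicator (Set.Ioc (0 : ℝ) 1) (fun _ => (1 : ℝ)) z

lemma integrableOn_min_one_sq {ν : Measure ℝ} (hν : IsLevyMeasure ν) :
    IntegrableOn (fun z : ℝ => min 1 (z ^ 2)) (Ioi 0) ν :=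
  (lintegral_ofReal_ne_top_iff_integrable (by fun_prop)
    (ae_of_all _ fun z => le_min zero_le_one (sq_nonneg z))).1 hν.2

lemma exp_neg_le_one_sub_add_sq {u : ℝ} (hu : 0 ≤ u) : Real.exp (-u) ≤ 1 - u + u ^ 2 := by
  have h1 : Real.exp (-u) * (1 + u) ≤ 1 := by
    calc Real.exp (-u) * (1 + u) ≤ Real.exp (-u) * Real.exp u := by
          gcongr
          linarith [Real.add_one_le_exp u]
      _ = 1 := by rw [← Real.exp_add]; simp
  have h2 : 1 ≤ (1 - u + u ^ 2) * (1 + u) := by nlinarith [pow_nonneg hu 3]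
  exact le_of_mul_le_mul_right (h1.trans h2) (by linarith)

lemma abs_levyIntegrand_le {l z : ℝ} (hl : 0 ≤ l) (hz : 0 < z) :
    |levyIntegrand l z| ≤ (1 + l ^ 2) * min 1 (z ^ 2) := by
  have hlz : 0 ≤ l * z := by positivity
  unfold levyIntegrand
  rcases le_or_gt z 1 with h | h
  · rw [indicator_of_mem (mem_Ioc.2 ⟨hz, h⟩), min_eq_right (by nlinarith), abs_of_nonneg]
    · have := exp_neg_le_one_sub_add_sq hlz
      rw [neg_mul]
      nlinarith [sq_nonneg z]
    · have := Real.add_one_le_exp (-l * z)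
      linarith
  · rw [indicator_of_notMem (fun hm => absurd hm.2 (not_le.2 h)), min_eq_left (by nlinarith)]
    have h1 : Real.exp (-l * z) ≤ 1 := Real.exp_le_one_iff.2 (by linarith)
    have h2 := Real.exp_pos (-l * z)
    rw [abs_le]
    constructor <;> nlinarith [sq_nonneg l]

lemma integrableOn_levyIntegrand {ν : Measure ℝ} (hν : IsLevyMeasure ν) {l : ℝ} (hl : 0 ≤ l) :
    IntegrableOn (levyIntegrand l) (Ioi 0) ν := by
  refine Integrable.mono' ((integrableOn_min_one_sq hν).const_mul (1 + l ^ 2)) ?_ ?_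
  · have : Measurable (levyIntegrand l) := by
      unfold levyIntegrand
      exact (by fun_prop : Measurable fun z : ℝ => Real.exp (-l * z) - 1).add
        ((by fun_prop : Measurable fun z : ℝ => l * z).mul
          (measurable_const.indicator measurableSet_Ioc))
    exact this.aestronglyMeasurable
  · exact (ae_restrict_mem measurableSet_Ioi).mono fun z hz => abs_levyIntegrand_le hl hz

lemma levyIntegrand_convexComb_lt {x y s t z : ℝ} (hxy : x ≠ y) (hs : 0 < s) (ht : 0 < t)
    (hst : s + t = 1) (hz : 0 < z) :
    levyIntegrand (s * x + t * y) z < s * levyIntegrand x z + t * levyIntegrand y z := by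
  have h := strictConvexOn_exp.2 (mem_univ (-x * z)) (mem_univ (-y * z))
    (by simpa [hz.ne'] using hxy) hs ht hst
  simp only [smul_eq_mul] at h
  unfold levyIntegrand
  set i := Set.indicator (Set.Ioc (0 : ℝ) 1) (fun _ => (1 : ℝ)) z
  have e : -(s * x + t * y) * z = s * (-x * z) + t * (-y * z) := by ring
  rw [e]
  obtain rfl : t = 1 - s := by linarith
  linarith

lemma levyPsi_eq (γ σ : ℝ) (ν : Measure ℝ) (l : ℝ) :
    levyPsi γ σ ν l = γ * l + σ ^ 2 / 2 * l ^ 2 + ∫ z in Ioi (0 : ℝ), levyIntegrand l z ∂ν := rfl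

lemma levyPsi_sub_const_mul (γ σ c : ℝ) (ν : Measure ℝ) (l : ℝ) :
    levyPsi γ σ ν l - c * l = levyPsi (γ - c) σ ν l := by
  rw [levyPsi_eq, levyPsi_eq]; ring

lemma strictConvexOn_levyPsi (γ σ : ℝ) {ν : Measure ℝ} (hν : IsLevyMeasure ν)
    (h : σ ≠ 0 ∨ ν ≠ 0) : StrictConvexOn ℝ (Ici 0) (levyPsi γ σ ν) := by
  refine ⟨convex_Ici 0, fun x hx y hy hxy s t hs ht hst => ?_⟩
  have hx' : 0 ≤ x := hx
  have hy' : 0 ≤ y := hy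
  simp only [smul_eq_mul]
  have hix := (integrableOn_levyIntegrand hν hx').const_mul s
  have hiy := (integrableOn_levyIntegrand hν hy').const_mul t
  have hixy := integrableOn_levyIntegrand hν (by positivity : 0 ≤ s * x + t * y)
  have hdiff : s * (∫ z in Ioi (0 : ℝ), levyIntegrand x z ∂ν) +
      t * (∫ z in Ioi (0 : ℝ), levyIntegrand y z ∂ν) -
      (∫ z in Ioi (0 : ℝ), levyIntegrand (s * x + t * y) z ∂ν) =
      ∫ z in Ioi (0 : ℝ), (s * levyIntegrand x z + t * levyIntegrand y z -
        levyIntegrand (s * x + t * y) z) ∂ν := by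
    rw [← integral_const_mul, ← integral_const_mul, ← integral_add hix hiy]
    exact (integral_sub (hix.add hiy) hixy).symm
  have hpos : ∀ z ∈ Ioi (0 : ℝ), 0 < s * levyIntegrand x z + t * levyIntegrand y z -
      levyIntegrand (s * x + t * y) z := fun z hz =>
    sub_pos.2 (levyIntegrand_convexComb_lt hxy hs ht hst hz)
  have hquad : s * x ^ 2 + t * y ^ 2 - (s * x + t * y) ^ 2 = s * t * (x - y) ^ 2 := by
    obtain rfl : t = 1 - s := by linarith
    ring
  have hsq : 0 < s * t * (x - y) ^ 2 := by
    have := sub_ne_zero.2 hxy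
    positivity
  suffices 0 < σ ^ 2 / 2 * (s * t * (x - y) ^ 2) +
      ∫ z in Ioi (0 : ℝ), (s * levyIntegrand x z + t * levyIntegrand y z -
        levyIntegrand (s * x + t * y) z) ∂ν by
    rw [levyPsi_eq, levyPsi_eq, levyPsi_eq]
    rw [← hdiff, ← hquad] at this
    linarith
  rcases h with h | h
  · have h1 : 0 < σ ^ 2 / 2 * (s * t * (x - y) ^ 2) := by positivity
    exact add_pos_of_pos_of_nonneg h1
      (setIntegral_nonneg measurableSet_Ioi fun z hz => (hpos z hz).le)
  · refine add_pos_of_nonneg_of_pos (by positivity) ?_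
    rw [setIntegral_pos_iff_support_of_nonneg_ae
      ((ae_restrict_mem measurableSet_Ioi).mono fun z hz => (hpos z hz).le) ((hix.add hiy).sub hixy),
      inter_eq_right.2 fun z hz => Function.mem_support.2 (hpos z hz).ne', pos_iff_ne_zero]
    intro h0
    refine h (Measure.measure_univ_eq_zero.1 ?_)
    rw [← Iic_union_Ioi (a := (0 : ℝ))]
    exact measure_union_null hν.1 h0

lemma StrictConvexOn.bddAbove_level_set {f : ℝ → ℝ} (hf : StrictConvexOn ℝ (Ici 0) f) (q : ℝ) :
    BddAbove {l : ℝ | 0 ≤ l ∧ f l = q} := by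
  by_contra hb
  rw [not_bddAbove_iff] at hb
  obtain ⟨x, ⟨hx, hxq⟩, -⟩ := hb 0
  obtain ⟨y, ⟨hy, hyq⟩, hxy⟩ := hb x
  obtain ⟨z, ⟨hz, hzq⟩, hyz⟩ := hb y
  have := hf.lt_on_openSegment (mem_Ici.2 hx) (mem_Ici.2 hz) (hxy.trans hyz).ne
    (by rw [openSegment_eq_Ioo (hxy.trans hyz)]; exact ⟨hxy, hyz⟩)
  simp [hxq, hyq, hzq] at this

lemma bddAbove_levyPsi_level_set (γ σ : ℝ) {ν : Measure ℝ} (hν : IsLevyMeasure ν)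
    (h : σ = 0 → ν = 0 → 0 < γ) (q : ℝ) :
    BddAbove {l : ℝ | 0 ≤ l ∧ levyPsi γ σ ν l = q} := by
  by_cases h0 : σ ≠ 0 ∨ ν ≠ 0
  · exact (strictConvexOn_levyPsi γ σ hν h0).bddAbove_level_set q
  · push Not at h0
    obtain ⟨rfl, rfl⟩ := h0
    have hγ := h rfl rfl
    refine ⟨q / γ, fun l ⟨_, hl⟩ => ?_⟩
    rw [le_div_iff₀ hγ, ← hl, levyPsi_eq]
    simp [mul_comm]

lemma levyPsi_ne_of_levyPhi_lt {γ σ : ℝ} {ν : Measure ℝ} (hν : IsLevyMeasure ν)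
    (h : σ = 0 → ν = 0 → 0 < γ) {q l : ℝ} (hl : levyPhi (levyPsi γ σ ν) q < l) (hl0 : 0 ≤ l) :
    levyPsi γ σ ν l ≠ q := fun he =>
  (le_csSup (bddAbove_levyPsi_level_set γ σ hν h q) ⟨hl0, he⟩).not_gt hl

lemma integral_comp_exp_neg_mul_eq_zero {k : ℝ → ℝ} (hk : IntegrableOn k (Ioi 0))
    (h : ∀ n : ℕ, ∫ y in Ioi (0 : ℝ), Real.exp (-y) ^ n * k y = 0) {φ : ℝ → ℝ}
    (hφ : ContinuousOn φ (Icc 0 1)) : ∫ y in Ioi (0 : ℝ), φ (Real.exp (-y)) * k y = 0 := by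
  have hmem : ∀ y ∈ Ioi (0 : ℝ), Real.exp (-y) ∈ Icc (0 : ℝ) 1 := fun y hy =>
    ⟨(Real.exp_pos _).le, Real.exp_le_one_iff.2 (neg_nonpos.2 (le_of_lt hy))⟩
  have hint : ∀ {f : ℝ → ℝ}, ContinuousOn f (Icc 0 1) →
      IntegrableOn (fun y => f (Real.exp (-y)) * k y) (Ioi 0) := by
    intro f hf
    obtain ⟨C, hC⟩ := isCompact_Icc.exists_bound_of_continuousOn hf
    refine Integrable.bdd_mul (c := C) hk ?_
      ((ae_restrict_mem measurableSet_Ioi).mono fun y hy => hC _ (hmem y hy))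
    exact (hf.comp (by fun_prop) hmem).aestronglyMeasurable measurableSet_Ioi
  have hpoly : ∀ p : Polynomial ℝ, ∫ y in Ioi (0 : ℝ), p.eval (Real.exp (-y)) * k y = 0 := by
    intro p
    simp_rw [Polynomial.eval_eq_sum_range, Finset.sum_mul, mul_assoc]
    rw [integral_finsetSum]
    · simp_rw [integral_const_mul, h]; simp
    · intro n _
      exact (hint (f := fun x => x ^ n) (by fun_prop)).const_mul _
  by_contra hne
  have hK : 0 ≤ ∫ y in Ioi (0 : ℝ), |k y| := integral_nonneg fun _ => abs_nonneg _
  have hpos := abs_pos.2 hne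
  obtain ⟨p, hp⟩ := exists_polynomial_near_of_continuousOn 0 1 φ hφ
    (|∫ y in Ioi (0 : ℝ), φ (Real.exp (-y)) * k y| / (1 + ∫ y in Ioi (0 : ℝ), |k y|))
    (by positivity)
  set I := |∫ y in Ioi (0 : ℝ), φ (Real.exp (-y)) * k y| with hI
  set K := ∫ y in Ioi (0 : ℝ), |k y|
  have hle : I ≤ I / (1 + K) * K := by
    have hs : ∫ y in Ioi (0 : ℝ), φ (Real.exp (-y)) * k y =
        -∫ y in Ioi (0 : ℝ), (p.eval (Real.exp (-y)) - φ (Real.exp (-y))) * k y := by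
      simp_rw [sub_mul]
      rw [integral_sub (hint (f := fun x => p.eval x) (by fun_prop)) (hint hφ), hpoly]
      simp
    have hI' : I = ‖∫ y in Ioi (0 : ℝ), (p.eval (Real.exp (-y)) - φ (Real.exp (-y))) * k y‖ := by
      rw [hI, hs, abs_neg, Real.norm_eq_abs]
    rw [← integral_const_mul]
    refine hI'.trans_le <| norm_integral_le_of_norm_le (hk.abs.const_mul _) ?_
    refine (ae_restrict_mem measurableSet_Ioi).mono fun y hy => ?_
    rw [norm_mul, Real.norm_eq_abs, Real.norm_eq_abs]
    gcongr
    exact (hp _ (hmem y hy)).le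
  rw [div_mul_eq_mul_div, le_div_iff₀ (by positivity)] at hle
  linarith

/-- A function whose Laplace transform vanishes on a half-line is zero almost everywhere. -/
lemma ae_eq_zero_of_laplace_eq_zero {h : ℝ → ℝ} {l₀ : ℝ}
    (hint : IntegrableOn (fun y => Real.exp (-l₀ * y) * h y) (Ioi 0))
    (hz : ∀ l, l₀ ≤ l → ∫ y in Ioi (0 : ℝ), Real.exp (-l * y) * h y = 0) :
    ∀ᵐ y, y ∈ Ioi (0 : ℝ) → h y = 0 := by
  have hn : ∀ n : ℕ, ∫ y in Ioi (0 : ℝ),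
      Real.exp (-y) ^ n * (Real.exp (-l₀ * y) * h y) = 0 := by
    intro n
    refine Eq.trans ?_ (hz (l₀ + n) (by simp))
    congr 1 with y
    rw [← Real.exp_nat_mul, ← mul_assoc, ← Real.exp_add]
    ring_nf
  have key := isOpen_Ioi.ae_eq_zero_of_integral_contDiff_smul_eq_zero
    (f := fun y => Real.exp (-l₀ * y) * h y) hint.locallyIntegrableOn ?_
  · filter_upwards [key] with y hy hy0
    simpa using hy hy0
  intro g hg hgc hgs
  have hg0 : ∀ y ∉ Ioi (0 : ℝ), g y = 0 := fun y hy =>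
    image_eq_zero_of_notMem_tsupport fun hm => hy (hgs hm)
  have hφ : Continuous fun u : ℝ => g (-Real.log u) := by
    rw [continuous_iff_continuousAt]
    intro u
    rcases eq_or_ne u 0 with rfl | hu
    · rw [continuousAt_iff_punctured_nhds]
      have h1 : Tendsto (fun u : ℝ => g (-Real.log u)) (𝓝[≠] 0) (𝓝 0) :=
        (hgc.is_zero_at_infty.mono_left atTop_le_cocompact).comp
          (tendsto_neg_atBot_atTop.comp Real.tendsto_log_nhdsNE_zero)
      simpa [hg0 0 (by simp)] using h1
    · exact hg.continuous.continuousAt.comp (Real.continuousAt_log hu).neg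
  have := integral_comp_exp_neg_mul_eq_zero hint hn hφ.continuousOn
  simp only [Real.log_exp, neg_neg] at this
  rw [← this, ← integral_indicator measurableSet_Ioi]
  congr 1 with y
  by_cases hy : y ∈ Ioi (0 : ℝ)
  · rw [indicator_of_mem hy, smul_eq_mul]
  · rw [indicator_of_notMem hy, hg0 y hy, zero_smul]

lemma eqOn_zero_of_laplace_eq_zero {h : ℝ → ℝ} {l₀ : ℝ} (hc : ContinuousOn h (Ioi 0))
    (hint : IntegrableOn (fun y => Real.exp (-l₀ * y) * h y) (Ioi 0))
    (hz : ∀ l, l₀ ≤ l → ∫ y in Ioi (0 : ℝ), Real.exp (-l * y) * h y = 0) :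
    EqOn h 0 (Ioi 0) :=
  Measure.eqOn_open_of_ae_eq (μ := volume)
    ((ae_restrict_iff' measurableSet_Ioi).2 (ae_eq_zero_of_laplace_eq_zero hint hz))
    isOpen_Ioi hc continuousOn_const

lemma tendsto_zero_of_add_monotone {E P H : ℝ → ℝ} {L : ℝ} (hE : IntegrableOn E (Ioi 0))
    (hP : Tendsto P atTop (𝓝 L)) (hH : MonotoneOn H (Ici 0)) (hEPH : ∀ y ∈ Ici 0, H y = E y + P y) :
    Tendsto E atTop (𝓝 0) := by
  have hM : Monotone fun y => H (max y 0) := fun x y hxy =>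
    hH (mem_Ici.2 (le_max_right _ _)) (mem_Ici.2 (le_max_right _ _)) (max_le_max_right 0 hxy)
  have hEM : (fun y => H (max y 0) - P y) =ᶠ[atTop] E := by
    filter_upwards [eventually_ge_atTop 0] with y hy
    rw [max_eq_left hy, hEPH y hy]; ring
  rcases tendsto_atTop_of_monotone hM with h | ⟨c, h⟩
  · have hE' : Tendsto E atTop atTop :=
      (h.atTop_add hP.neg).congr' (by simpa [sub_eq_add_neg] using hEM)
    obtain ⟨a, ha⟩ := eventually_atTop.1 ((hE'.eventually_ge_atTop 1).and (eventually_ge_atTop 0))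
    have h1 : IntegrableOn (fun _ : ℝ => (1 : ℝ)) (Ioi a) := by
      refine Integrable.mono' (hE.mono_set (Ioi_subset_Ioi (ha a le_rfl).2)) (by fun_prop) ?_
      refine (ae_restrict_mem measurableSet_Ioi).mono fun y hy => ?_
      simpa using (ha y (le_of_lt hy)).1
    simp [integrableOn_const_iff] at h1
  · have hE' : Tendsto E atTop (𝓝 (c - L)) := (h.sub hP).congr' hEM
    have := IntegrableAtFilter.eq_zero_of_tendsto (l := atTop) ⟨Ioi 0, Ioi_mem_atTop 0, hE⟩ ?_ hE'
    · rwa [this] at hE'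
    · intro s hs
      obtain ⟨a, ha⟩ := mem_atTop_sets.1 hs
      exact top_unique (by rw [← Real.volume_Ici (a := a)]; exact measure_mono ha)

lemma laplace_deriv {W W' : ℝ → ℝ} {l : ℝ} (hc : ContinuousOn W (Ici 0))
    (hm : MonotoneOn W (Ici 0)) (hd : ∀ y, 0 < y → HasDerivAt W (W' y) y)
    (hint : IntegrableOn (fun y => Real.exp (-l * y) * W y) (Ioi 0)) :
    IntegrableOn (fun y => Real.exp (-l * y) * W' y) (Ioi 0) ∧
      ∫ y in Ioi (0 : ℝ), Real.exp (-l * y) * W' y =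
        l * (∫ y in Ioi (0 : ℝ), Real.exp (-l * y) * W y) - W 0 := by
  have hW'0 : ∀ y ∈ Ioi (0 : ℝ), 0 ≤ Real.exp (-l * y) * W' y := fun y hy => by
    have h1 := hm.derivWithin_nonneg (x := y)
    rw [derivWithin_of_mem_nhds (Ici_mem_nhds hy), (hd y hy).deriv] at h1
    positivity
  set F : ℝ → ℝ := fun t => Real.exp (-l * t) * W (max t 0) with hF
  have hFc : Continuous F := by
    have : Continuous fun t => W (max t 0) :=
      hc.comp_continuous (by fun_prop) fun t => le_max_right t 0
    exact (by fun_prop : Continuous fun t : ℝ => Real.exp (-l * t)).mul this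
  have hFE : ∀ y ∈ Ici (0 : ℝ), F y = Real.exp (-l * y) * W y := fun y hy => by
    simp only [hF, max_eq_left (mem_Ici.1 hy)]
  have hFint : IntegrableOn F (Ioi 0) :=
    hint.congr_fun (fun y hy => (hFE y (mem_Ici_of_Ioi hy)).symm) measurableSet_Ioi
  have hFeq : ∫ y in Ioi (0 : ℝ), F y = ∫ y in Ioi (0 : ℝ), Real.exp (-l * y) * W y :=
    setIntegral_congr_fun measurableSet_Ioi fun y hy => hFE y (mem_Ici_of_Ioi hy)
  set H : ℝ → ℝ := fun y => F y + l * ∫ t in (0 : ℝ)..y, F t with hH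
  have hPd : ∀ y, HasDerivAt (fun y => l * ∫ t in (0 : ℝ)..y, F t) (l * F y) y := fun y =>
    (hFc.integral_hasStrictDerivAt 0 y).hasDerivAt.const_mul l
  have hHc : Continuous H :=
    hFc.add (continuous_iff_continuousAt.2 fun y => (hPd y).continuousAt)
  have hHd : ∀ y ∈ Ioi (0 : ℝ), HasDerivAt H (Real.exp (-l * y) * W' y) y := fun y hy => by
    have h1 : HasDerivAt (fun y => Real.exp (-l * y)) (Real.exp (-l * y) * (-l)) y := by
      simpa using ((hasDerivAt_id y).const_mul (-l)).exp
    have h2 : HasDerivAt F (Real.exp (-l * y) * (-l) * W y + Real.exp (-l * y) * W' y) y :=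
      (h1.mul (hd y hy)).congr_of_eventuallyEq <| by
        filter_upwards [Ici_mem_nhds hy] with t ht using hFE t ht
    convert! h2.add (hPd y) using 1
    rw [hFE y (mem_Ici_of_Ioi hy)]; ring
  have hHm : MonotoneOn H (Ici 0) := by
    refine monotoneOn_of_deriv_nonneg (convex_Ici 0) hHc.continuousOn ?_ ?_ <;>
      rw [interior_Ici]
    · exact fun y hy => (hHd y hy).differentiableAt.differentiableWithinAt
    · exact fun y hy => (hHd y hy).deriv ▸ hW'0 y hy
  have hP : Tendsto (fun y => l * ∫ t in (0 : ℝ)..y, F t) atTop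
      (𝓝 (l * ∫ y in Ioi (0 : ℝ), F y)) :=
    (intervalIntegral_tendsto_integral_Ioi 0 hFint tendsto_id).const_mul l
  have hHt : Tendsto H atTop (𝓝 (l * ∫ y in Ioi (0 : ℝ), F y)) := by
    simpa using (tendsto_zero_of_add_monotone hFint hP hHm fun y _ => rfl).add hP
  refine ⟨integrableOn_Ioi_deriv_of_nonneg hHc.continuousWithinAt hHd hW'0 hHt, ?_⟩
  rw [integral_Ioi_of_hasDerivAt_of_nonneg hHc.continuousWithinAt hHd hW'0 hHt, hFeq]
  simp [hH, hF]

lemma measurable_of_continuousOn_Ici {V : ℝ → ℝ} (h0 : ∀ x < 0, V x = 0)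
    (hc : ContinuousOn V (Ici 0)) : Measurable V := by
  have : V = (Ici (0 : ℝ)).piecewise V 0 := by
    ext x
    by_cases hx : x ∈ Ici (0 : ℝ)
    · simp [hx]
    · simp only [hx, not_false_eq_true, piecewise_eq_of_notMem, Pi.zero_apply]
      exact h0 x (not_le.1 hx)
  rw [this]
  exact hc.measurable_piecewise continuousOn_const measurableSet_Ici

lemma continuousAt_of_continuousOn_Ici {V : ℝ → ℝ} (h0 : ∀ x < 0, V x = 0)
    (hc : ContinuousOn V (Ici 0)) {t : ℝ} (ht : t ≠ 0) : ContinuousAt V t := by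
  rcases ht.lt_or_gt with ht | ht
  · exact (continuousAt_const (y := (0 : ℝ))).congr <| by
      filter_upwards [Iio_mem_nhds ht] with s hs using (h0 s hs).symm
  · exact hc.continuousAt (Ici_mem_nhds ht)

lemma abs_le_of_monotoneOn_Ici {V : ℝ → ℝ} (h0 : ∀ x < 0, V x = 0)
    (hm : MonotoneOn V (Ici 0)) {t X : ℝ} (ht : t ≤ X) : |V t| ≤ |V 0| + |V X| := by
  rcases lt_or_ge t 0 with h | h
  · rw [h0 t h, abs_zero]; positivity
  · have h1 := hm (mem_Ici.2 le_rfl) (mem_Ici.2 h) h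
    have h2 := hm (mem_Ici.2 h) (mem_Ici.2 (h.trans ht)) ht
    rw [abs_le]
    constructor
    · linarith [neg_abs_le (V 0), abs_nonneg (V X)]
    · linarith [le_abs_self (V X), abs_nonneg (V 0)]

lemma integrableOn_Ioc_of_laplace {f : ℝ → ℝ} {l : ℝ}
    (hf : IntegrableOn (fun y => Real.exp (-l * y) * f y) (Ioi 0)) (X : ℝ) :
    IntegrableOn f (Ioc 0 X) := by
  have hc : Continuous fun y : ℝ => Real.exp (l * y) := by fun_prop
  have := (hf.mono_set Ioc_subset_Ioi_self).continuousOn_mul_of_subset hc.continuousOn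
    isCompact_Icc measurableSet_Ioc (Ioc_subset_Icc_self (a := 0) (b := X))
  refine this.congr_fun (fun y _ => ?_) measurableSet_Ioc
  simp [← mul_assoc, ← Real.exp_add]

lemma integrableOn_convolution_integrand {V f : ℝ → ℝ} (h0 : ∀ x < 0, V x = 0)
    (hc : ContinuousOn V (Ici 0)) (hm : MonotoneOn V (Ici 0))
    (hf : ∀ X, IntegrableOn f (Ioc 0 X)) (x X : ℝ) :
    IntegrableOn (fun y => V (x - y) * f y) (Ioc 0 X) := by
  refine Integrable.bdd_mul (c := |V 0| + |V x|) (hf X)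
    ((measurable_of_continuousOn_Ici h0 hc).comp (by fun_prop)).aestronglyMeasurable ?_
  refine (ae_restrict_mem measurableSet_Ioc).mono fun y hy => ?_
  exact abs_le_of_monotoneOn_Ici h0 hm (by linarith [hy.1])

lemma continuousOn_convolution {V f : ℝ → ℝ} (h0 : ∀ x < 0, V x = 0)
    (hc : ContinuousOn V (Ici 0)) (hm : MonotoneOn V (Ici 0))
    (hf : ∀ X, IntegrableOn f (Ioc 0 X)) :
    ContinuousOn (fun x => ∫ y in (0 : ℝ)..x, V (x - y) * f y) (Ioi 0) := by
  intro x₀ hx₀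
  refine ContinuousAt.continuousWithinAt ?_
  have heq : (fun x => ∫ y in Ioc 0 (x₀ + 1), V (x - y) * f y) =ᶠ[𝓝 x₀]
      fun x => ∫ y in (0 : ℝ)..x, V (x - y) * f y := by
    filter_upwards [Ioo_mem_nhds (mem_Ioi.1 hx₀) (lt_add_one x₀)] with x hx
    rw [intervalIntegral.integral_of_le hx.1.le]
    refine setIntegral_eq_of_subset_of_forall_sdiff_eq_zero measurableSet_Ioc
      (Ioc_subset_Ioc_right hx.2.le) fun y hy => ?_
    rw [h0 _ (sub_neg.2 (not_le.1 fun hle => hy.2 ⟨hy.1.1, hle⟩)), zero_mul]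
  refine ContinuousAt.congr ?_ heq
  refine continuousAt_of_dominated (bound := fun y => (|V 0| + |V (x₀ + 1)|) * |f y|)
    (.of_forall fun x => (integrableOn_convolution_integrand h0 hc hm hf x _).1) ?_
    ((hf _).abs.const_mul _) ?_
  · filter_upwards [Iio_mem_nhds (lt_add_one x₀)] with x hx
    refine (ae_restrict_mem measurableSet_Ioc).mono fun y hy => ?_
    rw [norm_mul]
    refine mul_le_mul_of_nonneg_right ?_ (norm_nonneg _)
    exact abs_le_of_monotoneOn_Ici h0 hm (by linarith [hy.1, mem_Iio.1 hx])
  · refine ae_restrict_of_ae ?_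
    filter_upwards [Measure.ae_ne volume x₀] with y hy
    exact ((continuousAt_of_continuousOn_Ici h0 hc (sub_ne_zero.2 hy.symm)).comp
      (f := fun x => x - y) (by fun_prop)).mul continuousAt_const

lemma laplace_convolution {V f : ℝ → ℝ} {l : ℝ}
    (hV : IntegrableOn (fun y => Real.exp (-l * y) * V y) (Ioi 0))
    (hf : IntegrableOn (fun y => Real.exp (-l * y) * f y) (Ioi 0)) :
    IntegrableOn (fun x => Real.exp (-l * x) * ∫ y in (0 : ℝ)..x, V (x - y) * f y) (Ioi 0) ∧
      ∫ x in Ioi (0 : ℝ), Real.exp (-l * x) * ∫ y in (0 : ℝ)..x, V (x - y) * f y =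
        (∫ y in Ioi (0 : ℝ), Real.exp (-l * y) * f y) *
          ∫ y in Ioi (0 : ℝ), Real.exp (-l * y) * V y := by
  have heq : ∀ x, Real.exp (-l * x) * ∫ y in (0 : ℝ)..x, V (x - y) * f y =
      ∫ y in (0 : ℝ)..x, ContinuousLinearMap.mul ℝ ℝ (Real.exp (-l * y) * f y)
        (Real.exp (-l * (x - y)) * V (x - y)) := by
    intro x
    rw [← intervalIntegral.integral_const_mul]
    congr 1 with y
    have : Real.exp (-l * x) = Real.exp (-l * y) * Real.exp (-l * (x - y)) := by
      rw [← Real.exp_add]; ring_nf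
    rw [this, ContinuousLinearMap.mul_apply']
    ring
  simp_rw [heq]
  exact ⟨(integrable_indicator_iff measurableSet_Ioi).1
    (integrable_posConvolution hf hV (ContinuousLinearMap.mul ℝ ℝ)),
    integral_posConvolution hf hV (ContinuousLinearMap.mul ℝ ℝ)⟩

/-- If `W` and `V` have Laplace transforms `1 / G(l)` and `1 / (G(l) - α l)`, then
`W + α V ⋆ W' = (1 - α W(0)) V` on `(0, ∞)`. -/
lemma add_convolution_deriv_eq {W W' V G : ℝ → ℝ} {α l₀ : ℝ}
    (hc : ContinuousOn W (Ici 0)) (hm : MonotoneOn W (Ici 0))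
    (hd : ∀ y, 0 < y → HasDerivAt W (W' y) y)
    (hV0 : ∀ x < 0, V x = 0) (hVc : ContinuousOn V (Ici 0)) (hVm : MonotoneOn V (Ici 0))
    (hG : ∀ l, l₀ ≤ l → G l ≠ 0) (hGα : ∀ l, l₀ ≤ l → G l - α * l ≠ 0)
    (hW : ∀ l, l₀ ≤ l → ∫ y in Ioi (0 : ℝ), Real.exp (-l * y) * W y = 1 / G l)
    (hV : ∀ l, l₀ ≤ l → ∫ y in Ioi (0 : ℝ), Real.exp (-l * y) * V y = 1 / (G l - α * l)) :
    (∀ X, IntegrableOn W' (Ioc 0 X)) ∧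
      ∀ x, 0 < x → W x + α * ∫ y in (0 : ℝ)..x, V (x - y) * W' y = (1 - α * W 0) * V x := by
  have hWi : ∀ l, l₀ ≤ l → IntegrableOn (fun y => Real.exp (-l * y) * W y) (Ioi 0) := fun l hl =>
    Integrable.of_integral_ne_zero (by rw [hW l hl]; exact one_div_ne_zero (hG l hl))
  have hVi : ∀ l, l₀ ≤ l → IntegrableOn (fun y => Real.exp (-l * y) * V y) (Ioi 0) := fun l hl =>
    Integrable.of_integral_ne_zero (by rw [hV l hl]; exact one_div_ne_zero (hGα l hl))
  have hW' := fun l hl => laplace_deriv hc hm hd (hWi l hl)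
  have hloc : ∀ X, IntegrableOn W' (Ioc 0 X) := integrableOn_Ioc_of_laplace (hW' l₀ le_rfl).1
  refine ⟨hloc, fun x hx => ?_⟩
  have hconv := fun l hl => laplace_convolution (hVi l hl) (hW' l hl).1
  set C : ℝ → ℝ := fun x => ∫ y in (0 : ℝ)..x, V (x - y) * W' y with hC
  have hexp : ∀ l y, Real.exp (-l * y) * (W y + α * C y - (1 - α * W 0) * V y) =
      Real.exp (-l * y) * W y + α * (Real.exp (-l * y) * C y) -
        (1 - α * W 0) * (Real.exp (-l * y) * V y) := fun l y => by ring
  have hzero := eqOn_zero_of_laplace_eq_zero (l₀ := l₀)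
    (h := fun y => W y + α * C y - (1 - α * W 0) * V y) ?_ ?_ ?_ hx
  · exact sub_eq_zero.1 hzero
  · have hCc : ContinuousOn C (Ioi 0) := continuousOn_convolution hV0 hVc hVm hloc
    exact ((hc.mono Ioi_subset_Ici_self).add (continuousOn_const.mul hCc)).sub
      (continuousOn_const.mul (hVc.mono Ioi_subset_Ici_self))
  · simp_rw [hexp]
    exact ((hWi l₀ le_rfl).add ((hconv l₀ le_rfl).1.const_mul α)).sub
      ((hVi l₀ le_rfl).const_mul _)
  · intro l hl
    simp_rw [hexp]
    have h1 : IntegrableOn (fun y => α * (Real.exp (-l * y) * C y)) (Ioi 0) :=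
      (hconv l hl).1.const_mul α
    have h2 := (hVi l hl).const_mul (1 - α * W 0)
    refine (integral_sub ((hWi l hl).add h1) h2).trans ?_
    simp only [Pi.add_apply]
    rw [integral_add (hWi l hl) h1,
      integral_const_mul, integral_const_mul, (hconv l hl).2, (hW' l hl).2, hW l hl, hV l hl]
    have := hG l hl
    have := hGα l hl
    field_simp
    ring

/-- For every `x > b`,
`W^{(q)}(x) + α∫_b^x 𝕎^{(q)}(x-y) W^{(q)′}(y) dy
  = (1 - α W^{(q)}(0)) 𝕎^{(q)}(x) - α∫₀^b 𝕎^{(q)}(x-y) W^{(q)′}(y) dy`. -/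
theorem refracted_w_representation
    (γ σ : ℝ) (hσ : 0 ≤ σ) (ν : Measure ℝ) (hν : IsLevyMeasure ν)
    (hnd : NonDegenerate γ σ ν)
    (α : ℝ) (hα : AlphaAdmissible γ σ α ν)
    (b : ℝ) (hb : 0 < b) (q : ℝ) (hq : 0 ≤ q)
    (W W' Wα : ℝ → ℝ)
    (hW : IsScaleFunction (levyPsi γ σ ν) (levyPhi (levyPsi γ σ ν) q) q W)
    (hW' : (∀ y : ℝ, 0 < y → HasDerivAt W (W' y) y) ∧ ContinuousOn W' (Set.Ioi 0))
    (hWα : IsScaleFunction (fun l => levyPsi γ σ ν l - α * l)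
      (levyPhi (fun l => levyPsi γ σ ν l - α * l) q) q Wα) :
    ∀ x : ℝ, b < x →
      W x + α * ∫ y in b..x, Wα (x - y) * W' y =
        (1 - α * W 0) * Wα x - α * ∫ y in (0:ℝ)..b, Wα (x - y) * W' y := by
  have hdrift : ∀ c : ℝ, (σ = 0 → smallJumpMass ν ≠ ⊤ → c < γ + (smallJumpMass ν).toReal) →
      σ = 0 → ν = 0 → 0 < γ - c := by
    rintro c h hσ0 rfl
    have := h hσ0 (by simp [smallJumpMass])
    simp only [smallJumpMass, Measure.restrict_zero, lintegral_zero_measure,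
      ENNReal.toReal_zero, add_zero] at this
    linarith
  have hd0 : σ = 0 → ν = 0 → 0 < γ := by
    simpa using hdrift 0 fun h1 h2 => by
      rcases hnd with h | h | h
      · exact absurd h1 h.ne'
      · exact absurd h h2
      · exact h
  have hdα := hdrift α fun h1 h2 => hα.2 ⟨h1, h2⟩
  obtain ⟨-, hWc, hWm, hWL⟩ := hW
  obtain ⟨hV0, hVc, hVm, hVL⟩ := hWα
  simp_rw [levyPsi_sub_const_mul] at hVL
  set l₀ : ℝ := max 0 (max (levyPhi (levyPsi γ σ ν) q) (levyPhi (levyPsi (γ - α) σ ν) q)) + 1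
  have hl₀ : ∀ l, l₀ ≤ l → 0 ≤ l ∧ levyPhi (levyPsi γ σ ν) q < l ∧
      levyPhi (levyPsi (γ - α) σ ν) q < l := fun l hl => by
    have h := (lt_add_one _).trans_le hl
    rw [max_lt_iff, max_lt_iff] at h
    exact ⟨h.1.le, h.2⟩
  have hsub : ∀ l, levyPsi γ σ ν l - q - α * l = levyPsi (γ - α) σ ν l - q := fun l => by
    rw [← levyPsi_sub_const_mul]; ring
  obtain ⟨hloc, hrep⟩ := add_convolution_deriv_eq (G := fun l => levyPsi γ σ ν l - q) (α := α)
    (l₀ := l₀) hWc hWm hW'.1 hV0 hVc hVm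
    (fun l hl => sub_ne_zero.2 (levyPsi_ne_of_levyPhi_lt hν hd0 (hl₀ l hl).2.1 (hl₀ l hl).1))
    (fun l hl => by
      rw [hsub]
      exact sub_ne_zero.2 (levyPsi_ne_of_levyPhi_lt hν hdα (hl₀ l hl).2.2 (hl₀ l hl).1))
    (fun l hl => hWL l (hl₀ l hl).2.1)
    (fun l hl => by rw [hsub]; exact hVL l (hl₀ l hl).2.2)
  intro x hx
  have hi := integrableOn_convolution_integrand hV0 hVc hVm hloc x x
  rw [← hrep x (hb.trans hx), ← intervalIntegral.integral_add_adjacent_intervals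
    (b := b) ((intervalIntegrable_iff_integrableOn_Ioc_of_le hb.le).2
      (hi.mono_set (Ioc_subset_Ioc_right hx.le)))
    ((intervalIntegrable_iff_integrableOn_Ioc_of_le hx.le).2
      (hi.mono_set (Ioc_subset_Ioc_left hb.le)))]
  ring
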